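/- arXiv:2310.00580 — 3 statements merged into one kernel-verified Lean document; each statement's English description precedes it below -/
import Mathlib

section
/- (Weight Function Lemma) Let T be a tree rooted at r, and let w be a weight function on T with w(r) = 0 and w(v) > 0 for every v ≠ r. For each vertex v ≠ r, let v⁺ denote the parent of v (the neighbor of v closer to r). If w(v⁺) ≥ 2·w(v) holds for every vertex v not adjacent to r, then w is valid: every r-unsolvable configuration p on T satisfies w(p) ≤ w(1_T). -/
open SimpleGraph Finset

def PebMove {V : Type*} [DecidableEq V] (G : SimpleGraph V) (p q : V → ℕ) : Prop :=
  ∃ u v, G.Adj u v ∧ 2 ≤ p u ∧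
    q = fun x => if x = u then p u - 2 else if x = v then p v + 1 else p x

def Solvable {V : Type*} [DecidableEq V] (G : SimpleGraph V) (r : V) (p : V → ℕ) : Prop :=
  ∃ q, Relation.ReflTransGen (PebMove G) p q ∧ 1 ≤ q r

noncomputable def confWeight {V : Type*} [Fintype V] (w : V → ℝ) (p : V → ℕ) : ℝ :=
  ∑ v, (p v : ℝ) * w v

def ValidWeight {V : Type*} [Fintype V] [DecidableEq V] (G : SimpleGraph V) (r : V)
    (w : V → ℝ) : Prop :=
  w r = 0 ∧ (∀ v, v ≠ r → 0 < w v) ∧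
    ∀ p : V → ℕ, ¬ Solvable G r p → confWeight w p ≤ confWeight w (fun _ => 1)

noncomputable def rootedPebblingNumber {V : Type*} [Fintype V] [DecidableEq V]
    (G : SimpleGraph V) (r : V) : ℕ :=
  sInf {N | ∀ p : V → ℕ, N ≤ ∑ v, p v → Solvable G r p}

noncomputable def pebblingNumber {V : Type*} [Fintype V] [DecidableEq V]
    (G : SimpleGraph V) : ℕ :=
  sInf {N | ∀ (r : V) (p : V → ℕ), N ≤ ∑ v, p v → Solvable G r p}

def cubeGraph (n : ℕ) : SimpleGraph (Fin n → Bool) :=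
  SimpleGraph.fromRel (fun x y => hammingDist x y = 1)

def addPendant {V : Type*} (G : SimpleGraph V) (a : V) : SimpleGraph (Option V) :=
  SimpleGraph.fromRel (fun x y =>
    match x, y with
    | some u, some v => G.Adj u v
    | none, some u => u = a
    | _, _ => False)

def lollipop (n m : ℕ) : SimpleGraph (Fin (n + 1) ⊕ Fin (m + 1)) :=
  SimpleGraph.fromRel (fun x y =>
    match x, y with
    | Sum.inl i, Sum.inl j => (i : ℕ) + 1 = (j : ℕ)
    | Sum.inl i, Sum.inr j => i = 0 ∧ j ≠ 0
    | Sum.inr i, Sum.inr j => i = 0 ∧ j ≠ 0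
    | _, _ => False)

theorem confWeight_move {V : Type*} [Fintype V] [DecidableEq V] (w : V → ℝ) (p : V → ℕ)
    (u v : V) (huv : u ≠ v) (hu : 2 ≤ p u) :
    confWeight w (fun x => if x = u then p u - 2 else if x = v then p v + 1 else p x)
      = confWeight w p - 2 * w u + w v := by
  have h : ∀ x, (((if x = u then p u - 2 else if x = v then p v + 1 else p x : ℕ) : ℝ)) * w x
      = (p x : ℝ) * w x - (if x = u then 2 * w x else 0) + (if x = v then w x else 0) := by
    intro x
    by_cases h1 : x = u
    · subst h1
      simp only [if_true, if_neg huv]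
      push_cast [Nat.cast_sub hu]
      ring
    · by_cases h2 : x = v
      · subst h2
        simp only [if_true, if_neg h1]
        push_cast
        ring
      · simp [h1, h2]
  unfold confWeight
  rw [Finset.sum_congr rfl (fun x _ => h x), Finset.sum_add_distrib, Finset.sum_sub_distrib]
  simp

theorem stmt3 {V : Type*} [Fintype V] [DecidableEq V] (G : SimpleGraph V)
    (hT : G.IsTree) (r : V) (par : V → V)
    (hpar : ∀ v, v ≠ r → G.Adj v (par v) ∧ G.dist r (par v) + 1 = G.dist r v)
    (w : V → ℝ) (h0 : w r = 0) (hpos : ∀ v, v ≠ r → 0 < w v)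
    (hdouble : ∀ v, v ≠ r → ¬ G.Adj v r → 2 * w v ≤ w (par v)) :
    ∀ p : V → ℕ, ¬ Solvable G r p → confWeight w p ≤ confWeight w (fun _ => 1) := by
  intro p
  have key : ∀ n : ℕ, ∀ p : V → ℕ, confWeight (fun _ => 1) p ≤ n → ¬ Solvable G r p →
      confWeight w p ≤ confWeight w (fun _ => 1) := by
    intro n
    induction n with
    | zero =>
      intro p hp _
      have hz : ∀ v, p v = 0 := by
        intro v
        have h1 : (p v : ℝ) ≤ confWeight (fun _ => 1) p := by
          unfold confWeight
          simp only [mul_one]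
          exact Finset.single_le_sum (f := fun v => (p v : ℝ))
            (fun i _ => Nat.cast_nonneg _) (Finset.mem_univ v)
        have h2 : (p v : ℝ) ≤ ((0 : ℕ) : ℝ) := h1.trans hp
        have h3 : p v ≤ 0 := by exact_mod_cast h2
        omega
      unfold confWeight
      refine Finset.sum_le_sum fun v _ => ?_
      rw [hz v]
      by_cases hv : v = r
      · simp [hv, h0]
      · have := hpos v hv
        push_cast
        linarith
    | succ n ih =>
      intro p hp hns
      by_cases hex : ∃ v, v ≠ r ∧ 2 ≤ p v
      · obtain ⟨v, hv, hpv⟩ := hex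
        by_cases hadj : G.Adj v r
        · exfalso
          apply hns
          refine ⟨_, Relation.ReflTransGen.single ⟨v, r, hadj, hpv, rfl⟩, ?_⟩
          simp [hv.symm]
        · have ha := (hpar v hv).1
          have hw := confWeight_move w p v (par v) ha.ne hpv
          have h1 := confWeight_move (fun _ => 1) p v (par v) ha.ne hpv
          have hm : PebMove G p _ := ⟨v, par v, ha, hpv, rfl⟩
          have hd := hdouble v hv hadj
          have := ih _ (by rw [h1]; push_cast at hp; linarith)
            (fun ⟨q, hq, hqr⟩ => hns ⟨q, Relation.ReflTransGen.head hm hq, hqr⟩)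
          linarith
      · push Not at hex
        unfold confWeight
        refine Finset.sum_le_sum fun v _ => ?_
        by_cases hv : v = r
        · simp [hv, h0]
        · have h2 : p v ≤ 1 := by have := hex v hv; omega
          exact mul_le_mul_of_nonneg_right (by exact_mod_cast h2) (hpos v hv).le
  obtain ⟨n, hn⟩ := exists_nat_ge (confWeight (fun _ => 1) p)
  exact key n p hn
end

section
/- Let G be the graph obtained from the 3-cube Q_3 by attaching a pendant root vertex r to one vertex u of Q_3. Define the weight function w by w(r) = 0, w(u) = 4, w(v) = 2 for the three neighbors of u in Q_3, w(v) = 4/3 for the three vertices at distance 2 from u in Q_3, and w(z) = 1 for the vertex z antipodal to u in Q_3. Then w is valid: every r-unsolvable configuration p on G satisfies w(p) ≤ w(1_G) = 15. -/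
open SimpleGraph Finset

noncomputable def w9 (u : Fin 3 → Bool) : Option (Fin 3 → Bool) → ℝ
  | none => 0
  | some v =>
    match (cubeGraph 3).dist u v with
    | 0 => 4
    | 1 => 2
    | 2 => 4 / 3
    | _ => 1

/-- The vertex of the cube whose difference with `u` is the binary expansion of `i`. -/
def pt (u : Fin 3 → Bool) (i : Fin 8) : Fin 3 → Bool :=
  fun j => xor (u j) (Nat.testBit i.val j.val)

theorem pt_bijective (u : Fin 3 → Bool) : Function.Bijective (pt u) := by
  revert u; decide +kernel

theorem pt_adj (u : Fin 3 → Bool) (i j : Fin 8) :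
    hammingDist (pt u i) (pt u j) = hammingDist (pt (fun _ => false) i) (pt (fun _ => false) j) := by
  revert u i j; decide +kernel

theorem cube_adj (x y : Fin 3 → Bool) : (cubeGraph 3).Adj x y ↔ hammingDist x y = 1 := by
  simp only [cubeGraph, SimpleGraph.fromRel_adj]
  constructor
  · rintro ⟨_, h | h⟩
    · exact h
    · rwa [hammingDist_comm]
  · intro h
    refine ⟨?_, Or.inl h⟩
    rintro rfl
    simp at h

theorem le_walk {x y : Fin 3 → Bool} (W : (cubeGraph 3).Walk x y) :
    hammingDist x y ≤ W.length := by
  induction W with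
  | nil => simp
  | @cons a b c h W ih =>
    have h1 := (cube_adj _ _).1 h
    have h2 := hammingDist_triangle a b c
    rw [SimpleGraph.Walk.length_cons]
    omega

theorem hd_step : ∀ x y : Fin 3 → Bool, hammingDist x y ≠ 0 →
    ∃ x', hammingDist x x' = 1 ∧ hammingDist x y = hammingDist x' y + 1 := by
  decide +kernel

theorem ex_walk (k : ℕ) : ∀ x y : Fin 3 → Bool, hammingDist x y = k →
    ∃ W : (cubeGraph 3).Walk x y, W.length = k := by
  induction k with
  | zero =>
    intro x y h
    obtain rfl := hammingDist_eq_zero.1 h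
    exact ⟨SimpleGraph.Walk.nil, rfl⟩
  | succ k ih =>
    intro x y h
    obtain ⟨x', h1, h2⟩ := hd_step x y (by omega)
    obtain ⟨W, hW⟩ := ih x' y (by omega)
    exact ⟨SimpleGraph.Walk.cons ((cube_adj _ _).2 h1) W, by simp [hW]⟩

theorem cube_dist (x y : Fin 3 → Bool) : (cubeGraph 3).dist x y = hammingDist x y := by
  obtain ⟨W, hW⟩ := ex_walk _ x y rfl
  apply le_antisymm
  · rw [← hW]; exact SimpleGraph.dist_le W
  · obtain ⟨W', hW'⟩ := (SimpleGraph.Walk.reachable W).exists_walk_length_eq_dist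
    rw [← hW']; exact le_walk W'

theorem pt_hd (u : Fin 3 → Bool) (i : Fin 8) :
    hammingDist u (pt u i) = ![0, 1, 1, 2, 1, 2, 2, 3] i := by
  revert u i; decide +kernel

theorem w9_pt (u : Fin 3 → Bool) (i : Fin 8) :
    w9 u (some (pt u i)) = (![4, 2, 2, 4 / 3, 2, 4 / 3, 4 / 3, 1] : Fin 8 → ℝ) i := by
  simp only [w9, cube_dist, pt_hd]
  fin_cases i <;> rfl

theorem confWeight_eq (u : Fin 3 → Bool) (p : Option (Fin 3 → Bool) → ℕ) :
    confWeight (w9 u) p =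
      4 * (p (some (pt u 0)) : ℝ) + 2 * (p (some (pt u 1)) : ℝ) + 2 * (p (some (pt u 2)) : ℝ)
      + 2 * (p (some (pt u 4)) : ℝ) + 4 / 3 * (p (some (pt u 3)) : ℝ)
      + 4 / 3 * (p (some (pt u 5)) : ℝ) + 4 / 3 * (p (some (pt u 6)) : ℝ)
      + (p (some (pt u 7)) : ℝ) := by
  have h0 : w9 u none = 0 := rfl
  rw [confWeight, Fintype.sum_option, h0,
    ← (pt_bijective u).sum_comp (fun v => (p (some v) : ℝ) * w9 u (some v))]
  simp only [w9_pt, Fin.sum_univ_eight]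
  simp
  ring

/-- `S u c`: every configuration dominating `c` on the cube is solvable. -/
def SC (u : Fin 3 → Bool) (c : Fin 8 → ℕ) : Prop :=
  ∀ p : Option (Fin 3 → Bool) → ℕ, (∀ i, c i ≤ p (some (pt u i))) →
    Solvable (addPendant (cubeGraph 3) u) none p

theorem SC.mono {u : Fin 3 → Bool} {c d : Fin 8 → ℕ} (h : SC u c) (hcd : ∀ i, c i ≤ d i) :
    SC u d := fun p hp => h p fun i => (hcd i).trans (hp i)

theorem SC.move {u : Fin 3 → Bool} {c : Fin 8 → ℕ} (d : Fin 8 → ℕ) (i j : Fin 8)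
    (hij : hammingDist (pt (fun _ => false) i) (pt (fun _ => false) j) = 1)
    (hd : SC u d)
    (hc : ∀ k, d k + (if k = i then 2 else 0) ≤ c k + (if k = j then 1 else 0)) : SC u c := by
  intro p hp
  have hne : i ≠ j := by
    rintro rfl
    simp at hij
  have hadj : (addPendant (cubeGraph 3) u).Adj (some (pt u i)) (some (pt u j)) := by
    have : (cubeGraph 3).Adj (pt u i) (pt u j) := by
      rw [cube_adj, pt_adj]; exact hij
    simp only [addPendant, SimpleGraph.fromRel_adj]
    refine ⟨?_, Or.inl this⟩
    simpa using this.ne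
  have hi := hc i
  rw [if_pos rfl, if_neg hne] at hi
  have hpi := hp i
  have key := hd (fun x => if x = some (pt u i) then p (some (pt u i)) - 2 else
    if x = some (pt u j) then p (some (pt u j)) + 1 else p x) (by
      intro k
      have hk := hc k
      have hpk := hp k
      have e : ∀ l, (some (pt u k) = some (pt u l)) ↔ k = l := fun l => by
        simp [(pt_bijective u).1.eq_iff]
      simp only [e]
      split_ifs at hk ⊢ with h1 h2 h3
      all_goals (try subst h1)
      all_goals (try subst h2)
      all_goals (try subst h3)
      all_goals omega)
  obtain ⟨q, hq, hq1⟩ := key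
  exact ⟨q, Relation.ReflTransGen.head ⟨_, _, hadj, by omega, rfl⟩ hq, hq1⟩

/-- The same predicate on tuples. -/
def TupSolv (u : Fin 3 → Bool) (n a b c x y w z : ℕ) : Prop := SC u ![n, a, b, x, c, y, w, z]

theorem TupSolv.mono {u : Fin 3 → Bool} {n a b c x y w z n' a' b' c' x' y' w' z' : ℕ}
    (h : TupSolv u n a b c x y w z) (h0 : n ≤ n') (h1 : a ≤ a') (h2 : b ≤ b') (h3 : c ≤ c')
    (h4 : x ≤ x') (h5 : y ≤ y') (h6 : w ≤ w') (h7 : z ≤ z') : TupSolv u n' a' b' c' x' y' w' z' :=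
  SC.mono h (by intro i; fin_cases i <;> simpa)

theorem TupSolv.done (u : Fin 3 → Bool) (n a b c x y w z : ℕ) (h : 2 ≤ n) :
    TupSolv u n a b c x y w z := by
  intro p hp
  have h0 : n ≤ p (some (pt u 0)) := by simpa using hp 0
  have e0 : pt u 0 = u := by
    have := pt_hd u 0
    exact (hammingDist_eq_zero.1 this).symm
  rw [e0] at h0
  refine ⟨_, Relation.ReflTransGen.single ⟨some u, none, ?_, by omega, rfl⟩, ?_⟩
  · simp [addPendant, SimpleGraph.fromRel_adj]
  · simp

theorem TupSolv.an {u : Fin 3 → Bool} {n a b c x y w z : ℕ} (h2 : 2 ≤ a)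
    (h : TupSolv u (n + 1) (a - 2) b c x y w z) : TupSolv u n a b c x y w z := by
  refine SC.move _ 1 0 (by decide +kernel) h ?_
  intro k
  fin_cases k <;> simp <;> omega

theorem TupSolv.bn {u : Fin 3 → Bool} {n a b c x y w z : ℕ} (h2 : 2 ≤ b)
    (h : TupSolv u (n + 1) a (b - 2) c x y w z) : TupSolv u n a b c x y w z := by
  refine SC.move _ 2 0 (by decide +kernel) h ?_
  intro k
  fin_cases k <;> simp <;> omega

theorem TupSolv.cn {u : Fin 3 → Bool} {n a b c x y w z : ℕ} (h2 : 2 ≤ c)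
    (h : TupSolv u (n + 1) a b (c - 2) x y w z) : TupSolv u n a b c x y w z := by
  refine SC.move _ 4 0 (by decide +kernel) h ?_
  intro k
  fin_cases k <;> simp <;> omega

theorem TupSolv.xa {u : Fin 3 → Bool} {n a b c x y w z : ℕ} (h2 : 2 ≤ x)
    (h : TupSolv u n (a + 1) b c (x - 2) y w z) : TupSolv u n a b c x y w z := by
  refine SC.move _ 3 1 (by decide +kernel) h ?_
  intro k
  fin_cases k <;> simp <;> omega

theorem TupSolv.xb {u : Fin 3 → Bool} {n a b c x y w z : ℕ} (h2 : 2 ≤ x)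
    (h : TupSolv u n a (b + 1) c (x - 2) y w z) : TupSolv u n a b c x y w z := by
  refine SC.move _ 3 2 (by decide +kernel) h ?_
  intro k
  fin_cases k <;> simp <;> omega

theorem TupSolv.ya {u : Fin 3 → Bool} {n a b c x y w z : ℕ} (h2 : 2 ≤ y)
    (h : TupSolv u n (a + 1) b c x (y - 2) w z) : TupSolv u n a b c x y w z := by
  refine SC.move _ 5 1 (by decide +kernel) h ?_
  intro k
  fin_cases k <;> simp <;> omega

theorem TupSolv.yc {u : Fin 3 → Bool} {n a b c x y w z : ℕ} (h2 : 2 ≤ y)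
    (h : TupSolv u n a b (c + 1) x (y - 2) w z) : TupSolv u n a b c x y w z := by
  refine SC.move _ 5 4 (by decide +kernel) h ?_
  intro k
  fin_cases k <;> simp <;> omega

theorem TupSolv.wb {u : Fin 3 → Bool} {n a b c x y w z : ℕ} (h2 : 2 ≤ w)
    (h : TupSolv u n a (b + 1) c x y (w - 2) z) : TupSolv u n a b c x y w z := by
  refine SC.move _ 6 2 (by decide +kernel) h ?_
  intro k
  fin_cases k <;> simp <;> omega

theorem TupSolv.wc {u : Fin 3 → Bool} {n a b c x y w z : ℕ} (h2 : 2 ≤ w)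
    (h : TupSolv u n a b (c + 1) x y (w - 2) z) : TupSolv u n a b c x y w z := by
  refine SC.move _ 6 4 (by decide +kernel) h ?_
  intro k
  fin_cases k <;> simp <;> omega

theorem TupSolv.zx {u : Fin 3 → Bool} {n a b c x y w z : ℕ} (h2 : 2 ≤ z)
    (h : TupSolv u n a b c (x + 1) y w (z - 2)) : TupSolv u n a b c x y w z := by
  refine SC.move _ 7 3 (by decide +kernel) h ?_
  intro k
  fin_cases k <;> simp <;> omega

theorem TupSolv.zy {u : Fin 3 → Bool} {n a b c x y w z : ℕ} (h2 : 2 ≤ z)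
    (h : TupSolv u n a b c x (y + 1) w (z - 2)) : TupSolv u n a b c x y w z := by
  refine SC.move _ 7 5 (by decide +kernel) h ?_
  intro k
  fin_cases k <;> simp <;> omega

theorem TupSolv.zw {u : Fin 3 → Bool} {n a b c x y w z : ℕ} (h2 : 2 ≤ z)
    (h : TupSolv u n a b c x y (w + 1) (z - 2)) : TupSolv u n a b c x y w z := by
  refine SC.move _ 7 6 (by decide +kernel) h ?_
  intro k
  fin_cases k <;> simp <;> omega

/-- A greedy search for a solution. -/
def srch : ℕ → ℕ → ℕ → ℕ → ℕ → ℕ → ℕ → ℕ → ℕ → Bool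
  | 0, n, _, _, _, _, _, _, _ => Nat.ble 2 n
  | f + 1, n, a, b, c, x, y, w, z =>
    Nat.ble 2 n ||
    (Nat.ble 2 a && srch f (n + 1) (a - 2) b c x y w z) ||
    (Nat.ble 2 b && srch f (n + 1) a (b - 2) c x y w z) ||
    (Nat.ble 2 c && srch f (n + 1) a b (c - 2) x y w z) ||
    (Nat.ble 2 x && Nat.ble 1 a && srch f n (a + 1) b c (x - 2) y w z) ||
    (Nat.ble 2 x && Nat.ble 1 b && srch f n a (b + 1) c (x - 2) y w z) ||
    (Nat.ble 2 y && Nat.ble 1 a && srch f n (a + 1) b c x (y - 2) w z) ||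
    (Nat.ble 2 y && Nat.ble 1 c && srch f n a b (c + 1) x (y - 2) w z) ||
    (Nat.ble 2 w && Nat.ble 1 b && srch f n a (b + 1) c x y (w - 2) z) ||
    (Nat.ble 2 w && Nat.ble 1 c && srch f n a b (c + 1) x y (w - 2) z) ||
    (Nat.ble 4 x && srch f n (a + 2) b c (x - 4) y w z) ||
    (Nat.ble 4 y && srch f n (a + 2) b c x (y - 4) w z) ||
    (Nat.ble 4 w && srch f n a (b + 2) c x y (w - 4) z) ||
    (Nat.ble 2 x && Nat.ble 2 y && srch f n (a + 2) b c (x - 2) (y - 2) w z) ||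
    (Nat.ble 2 x && Nat.ble 2 w && srch f n a (b + 2) c (x - 2) y (w - 2) z) ||
    (Nat.ble 2 y && Nat.ble 2 w && srch f n a b (c + 2) x (y - 2) (w - 2) z) ||
    (Nat.ble 2 z && Nat.beq (x % 2) 1 && srch f n a b c (x + 1) y w (z - 2)) ||
    (Nat.ble 2 z && Nat.beq (y % 2) 1 && srch f n a b c x (y + 1) w (z - 2)) ||
    (Nat.ble 2 z && Nat.beq (w % 2) 1 && srch f n a b c x y (w + 1) (z - 2)) ||
    (Nat.ble 4 z && srch f n a b c (x + 2) y w (z - 4)) ||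
    (Nat.ble 4 z && srch f n a b c x (y + 2) w (z - 4)) ||
    (Nat.ble 4 z && srch f n a b c x y (w + 2) (z - 4))

theorem srch_sound (u : Fin 3 → Bool) (f : ℕ) : ∀ n a b c x y w z : ℕ,
    srch f n a b c x y w z = true → TupSolv u n a b c x y w z := by
  induction f with
  | zero =>
    intro n a b c x y w z h
    exact TupSolv.done _ _ _ _ _ _ _ _ _ (Nat.le_of_ble_eq_true h)
  | succ f ih =>
    intro n a b c x y w z h
    simp only [srch, Bool.or_eq_true, Bool.and_eq_true, Nat.ble_eq, or_assoc, and_assoc] at h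
    rcases h with h | h | h | h | h | h | h | h | h | h | h | h | h | h | h | h | h | h | h | h | h | h
    · exact TupSolv.done _ _ _ _ _ _ _ _ _ h
    · obtain ⟨h1, h⟩ := h
      refine TupSolv.an (by omega) ?_
      exact (ih _ _ _ _ _ _ _ _ h).mono (by omega) (by omega) (by omega) (by omega)
        (by omega) (by omega) (by omega) (by omega)
    · obtain ⟨h1, h⟩ := h
      refine TupSolv.bn (by omega) ?_
      exact (ih _ _ _ _ _ _ _ _ h).mono (by omega) (by omega) (by omega) (by omega)
        (by omega) (by omega) (by omega) (by omega)
    · obtain ⟨h1, h⟩ := h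
      refine TupSolv.cn (by omega) ?_
      exact (ih _ _ _ _ _ _ _ _ h).mono (by omega) (by omega) (by omega) (by omega)
        (by omega) (by omega) (by omega) (by omega)
    · obtain ⟨h1, h2, h⟩ := h
      refine TupSolv.xa (by omega) ?_
      exact (ih _ _ _ _ _ _ _ _ h).mono (by omega) (by omega) (by omega) (by omega)
        (by omega) (by omega) (by omega) (by omega)
    · obtain ⟨h1, h2, h⟩ := h
      refine TupSolv.xb (by omega) ?_
      exact (ih _ _ _ _ _ _ _ _ h).mono (by omega) (by omega) (by omega) (by omega)
        (by omega) (by omega) (by omega) (by omega)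
    · obtain ⟨h1, h2, h⟩ := h
      refine TupSolv.ya (by omega) ?_
      exact (ih _ _ _ _ _ _ _ _ h).mono (by omega) (by omega) (by omega) (by omega)
        (by omega) (by omega) (by omega) (by omega)
    · obtain ⟨h1, h2, h⟩ := h
      refine TupSolv.yc (by omega) ?_
      exact (ih _ _ _ _ _ _ _ _ h).mono (by omega) (by omega) (by omega) (by omega)
        (by omega) (by omega) (by omega) (by omega)
    · obtain ⟨h1, h2, h⟩ := h
      refine TupSolv.wb (by omega) ?_
      exact (ih _ _ _ _ _ _ _ _ h).mono (by omega) (by omega) (by omega) (by omega)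
        (by omega) (by omega) (by omega) (by omega)
    · obtain ⟨h1, h2, h⟩ := h
      refine TupSolv.wc (by omega) ?_
      exact (ih _ _ _ _ _ _ _ _ h).mono (by omega) (by omega) (by omega) (by omega)
        (by omega) (by omega) (by omega) (by omega)
    · obtain ⟨h1, h⟩ := h
      refine TupSolv.xa (by omega) ?_
      refine TupSolv.xa (by omega) ?_
      exact (ih _ _ _ _ _ _ _ _ h).mono (by omega) (by omega) (by omega) (by omega)
        (by omega) (by omega) (by omega) (by omega)
    · obtain ⟨h1, h⟩ := h
      refine TupSolv.ya (by omega) ?_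
      refine TupSolv.ya (by omega) ?_
      exact (ih _ _ _ _ _ _ _ _ h).mono (by omega) (by omega) (by omega) (by omega)
        (by omega) (by omega) (by omega) (by omega)
    · obtain ⟨h1, h⟩ := h
      refine TupSolv.wb (by omega) ?_
      refine TupSolv.wb (by omega) ?_
      exact (ih _ _ _ _ _ _ _ _ h).mono (by omega) (by omega) (by omega) (by omega)
        (by omega) (by omega) (by omega) (by omega)
    · obtain ⟨h1, h2, h⟩ := h
      refine TupSolv.xa (by omega) ?_
      refine TupSolv.ya (by omega) ?_
      exact (ih _ _ _ _ _ _ _ _ h).mono (by omega) (by omega) (by omega) (by omega)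
        (by omega) (by omega) (by omega) (by omega)
    · obtain ⟨h1, h2, h⟩ := h
      refine TupSolv.xb (by omega) ?_
      refine TupSolv.wb (by omega) ?_
      exact (ih _ _ _ _ _ _ _ _ h).mono (by omega) (by omega) (by omega) (by omega)
        (by omega) (by omega) (by omega) (by omega)
    · obtain ⟨h1, h2, h⟩ := h
      refine TupSolv.yc (by omega) ?_
      refine TupSolv.wc (by omega) ?_
      exact (ih _ _ _ _ _ _ _ _ h).mono (by omega) (by omega) (by omega) (by omega)
        (by omega) (by omega) (by omega) (by omega)
    · obtain ⟨h1, h2, h⟩ := h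
      refine TupSolv.zx (by omega) ?_
      exact (ih _ _ _ _ _ _ _ _ h).mono (by omega) (by omega) (by omega) (by omega)
        (by omega) (by omega) (by omega) (by omega)
    · obtain ⟨h1, h2, h⟩ := h
      refine TupSolv.zy (by omega) ?_
      exact (ih _ _ _ _ _ _ _ _ h).mono (by omega) (by omega) (by omega) (by omega)
        (by omega) (by omega) (by omega) (by omega)
    · obtain ⟨h1, h2, h⟩ := h
      refine TupSolv.zw (by omega) ?_
      exact (ih _ _ _ _ _ _ _ _ h).mono (by omega) (by omega) (by omega) (by omega)
        (by omega) (by omega) (by omega) (by omega)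
    · obtain ⟨h1, h⟩ := h
      refine TupSolv.zx (by omega) ?_
      refine TupSolv.zx (by omega) ?_
      exact (ih _ _ _ _ _ _ _ _ h).mono (by omega) (by omega) (by omega) (by omega)
        (by omega) (by omega) (by omega) (by omega)
    · obtain ⟨h1, h⟩ := h
      refine TupSolv.zy (by omega) ?_
      refine TupSolv.zy (by omega) ?_
      exact (ih _ _ _ _ _ _ _ _ h).mono (by omega) (by omega) (by omega) (by omega)
        (by omega) (by omega) (by omega) (by omega)
    · obtain ⟨h1, h⟩ := h
      refine TupSolv.zw (by omega) ?_
      refine TupSolv.zw (by omega) ?_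
      exact (ih _ _ _ _ _ _ _ _ h).mono (by omega) (by omega) (by omega) (by omega)
        (by omega) (by omega) (by omega) (by omega)

/-- Bounded universal quantifier, computed. -/
def allB : ℕ → (ℕ → Bool) → Bool
  | 0, _ => true
  | k + 1, P => P k && allB k P

theorem allB_spec (k : ℕ) (P : ℕ → Bool) (h : allB k P = true) : ∀ i < k, P i = true := by
  induction k with
  | zero => intro i hi; omega
  | succ k ih =>
    simp only [allB, Bool.and_eq_true] at h
    intro i hi
    rcases Nat.lt_succ_iff_lt_or_eq.1 hi with h1 | h1
    · exact ih h.2 i h1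
    · rw [h1]; exact h.1

theorem check : (allB 2 fun n => allB 2 fun a => allB 2 fun b => allB 2 fun c =>
    allB 8 fun x => allB 8 fun y => allB 8 fun w =>
      Nat.ble 50 (12 * n + 6 * (a + b + c) + 4 * (x + y + w)) ||
      srch 20 n a b c x y w ((48 - (12 * n + 6 * (a + b + c) + 4 * (x + y + w))) / 3)) = true := by
  decide +kernel

theorem core_small (u : Fin 3 → Bool) (n a b c x y w z : ℕ) (hn : n < 2) (ha : a < 2) (hb : b < 2)
    (hc : c < 2)
    (hT : 12 * n + 6 * (a + b + c) + 4 * (x + y + w) < 50)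
    (h : 46 ≤ 12 * n + 6 * (a + b + c) + 4 * (x + y + w) + 3 * z) :
    TupSolv u n a b c x y w z := by
  by_cases hx : x < 8
  · by_cases hy : y < 8
    · by_cases hw : w < 8
      · have h1 := allB_spec _ _ check n hn
        have h2 := allB_spec _ _ h1 a ha
        have h3 := allB_spec _ _ h2 b hb
        have h4 := allB_spec _ _ h3 c hc
        have h5 := allB_spec _ _ h4 x hx
        have h6 := allB_spec _ _ h5 y hy
        have h7 := allB_spec _ _ h6 w hw
        rw [Bool.or_eq_true, Nat.ble_eq] at h7
        replace h7 := h7.resolve_left (by omega)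
        exact (srch_sound u _ _ _ _ _ _ _ _ _ h7).mono le_rfl le_rfl le_rfl le_rfl le_rfl le_rfl
          le_rfl (by omega)
      · exact (srch_sound u 20 0 0 0 0 0 0 8 0 (by decide +kernel)).mono (by omega) (by omega)
          (by omega) (by omega) (by omega) (by omega) (by omega) (by omega)
    · exact (srch_sound u 20 0 0 0 0 0 8 0 0 (by decide +kernel)).mono (by omega) (by omega)
        (by omega) (by omega) (by omega) (by omega) (by omega) (by omega)
  · exact (srch_sound u 20 0 0 0 0 8 0 0 0 (by decide +kernel)).mono (by omega) (by omega)
      (by omega) (by omega) (by omega) (by omega) (by omega) (by omega)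

theorem core (u : Fin 3 → Bool) (n a b c z : ℕ) (hn : n < 2) (ha : a < 2) (hb : b < 2)
    (hc : c < 2) (k : ℕ) : ∀ x y w : ℕ, k = x + y + w →
    46 ≤ 12 * n + 6 * (a + b + c) + 4 * (x + y + w) + 3 * z → TupSolv u n a b c x y w z := by
  induction k with
  | zero =>
    intro x y w hk h
    exact core_small u n a b c x y w z hn ha hb hc (by omega) h
  | succ k ih =>
    intro x y w hk h
    by_cases hT : 12 * n + 6 * (a + b + c) + 4 * (x + y + w) < 50
    · exact core_small u n a b c x y w z hn ha hb hc hT h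
    · by_cases hx : 0 < x
      · exact (ih (x - 1) y w (by omega) (by omega)).mono le_rfl le_rfl le_rfl le_rfl
          (by omega) le_rfl le_rfl le_rfl
      · by_cases hy : 0 < y
        · exact (ih x (y - 1) w (by omega) (by omega)).mono le_rfl le_rfl le_rfl le_rfl
            le_rfl (by omega) le_rfl le_rfl
        · exact (ih x y (w - 1) (by omega) (by omega)).mono le_rfl le_rfl le_rfl le_rfl
            le_rfl le_rfl (by omega) le_rfl

/-- Moves from a neighbour of `u` to `u` preserve the weight, so they may be made first. -/
theorem full (u : Fin 3 → Bool) (k : ℕ) : ∀ n a b c x y w z : ℕ, k = a + b + c →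
    46 ≤ 12 * n + 6 * (a + b + c) + 4 * (x + y + w) + 3 * z → TupSolv u n a b c x y w z := by
  induction k using Nat.strong_induction_on with
  | _ k ih =>
    intro n a b c x y w z hk h
    by_cases hn : n < 2
    · by_cases ha : a < 2
      · by_cases hb : b < 2
        · by_cases hc : c < 2
          · exact core u n a b c z hn ha hb hc _ x y w rfl h
          · exact TupSolv.cn (by omega) (ih _ (by omega) _ _ _ _ _ _ _ _ rfl (by omega))
        · exact TupSolv.bn (by omega) (ih _ (by omega) _ _ _ _ _ _ _ _ rfl (by omega))
      · exact TupSolv.an (by omega) (ih _ (by omega) _ _ _ _ _ _ _ _ rfl (by omega))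
    · exact TupSolv.done _ _ _ _ _ _ _ _ _ (by omega)

theorem stmt9 (u : Fin 3 → Bool) :
    confWeight (w9 u) (fun _ => 1) = 15 ∧
    ∀ p : Option (Fin 3 → Bool) → ℕ,
      ¬ Solvable (addPendant (cubeGraph 3) u) none p → confWeight (w9 u) p ≤ 15 := by
  constructor
  · rw [confWeight_eq]
    norm_num
  · intro p hp
    by_contra hlt
    apply hp
    have key : 46 ≤ 12 * p (some (pt u 0)) +
        6 * (p (some (pt u 1)) + p (some (pt u 2)) + p (some (pt u 4))) +
        4 * (p (some (pt u 3)) + p (some (pt u 5)) + p (some (pt u 6))) +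
        3 * p (some (pt u 7)) := by
      rw [confWeight_eq] at hlt
      have : (45 : ℝ) < ((12 * p (some (pt u 0)) +
        6 * (p (some (pt u 1)) + p (some (pt u 2)) + p (some (pt u 4))) +
        4 * (p (some (pt u 3)) + p (some (pt u 5)) + p (some (pt u 6))) +
        3 * p (some (pt u 7)) : ℕ) : ℝ) := by
        push_cast
        linarith
      exact_mod_cast this
    exact full u _ _ _ _ _ _ _ _ _ rfl key p (by intro i; fin_cases i <;> simp)
end

section
/- Let Q_4 be the 4-dimensional hypercube with vertex set {0,1}^4, rooted at r = (0,0,0,0). Define w*(r) = 0 and w*(v) = 4 for all v ≠ r. Then w* is valid: every r-unsolvable configuration p on Q_4 satisfies w*(p) ≤ w*(1_{Q_4}) = 60. Equivalently, every configuration on Q_4 with at least 16 pebbles is r-solvable. -/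
open SimpleGraph Finset

section PebbleHelpers

/-- From `p` one can reach a configuration dominating `q`. -/
def Reach {V : Type*} [DecidableEq V] (G : SimpleGraph V) (p q : V → ℕ) : Prop :=
  ∃ c, Relation.ReflTransGen (PebMove G) p c ∧ q ≤ c

theorem PebMove.add_right {V : Type*} [DecidableEq V] {G : SimpleGraph V} {p q : V → ℕ}
    (h : PebMove G p q) (s : V → ℕ) : PebMove G (p + s) (q + s) := by
  obtain ⟨u, v, huv, h2, rfl⟩ := h
  refine ⟨u, v, huv, ?_, ?_⟩
  · simp only [Pi.add_apply]; omega
  · funext x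
    simp only [Pi.add_apply]
    split_ifs with h1 h3
    · subst h1; omega
    · subst h3; omega
    · rfl

theorem rtg_add_right {V : Type*} [DecidableEq V] {G : SimpleGraph V} {p q : V → ℕ}
    (h : Relation.ReflTransGen (PebMove G) p q) (s : V → ℕ) :
    Relation.ReflTransGen (PebMove G) (p + s) (q + s) := by
  induction h with
  | refl => exact .refl
  | tail _ h ih => exact ih.tail (h.add_right s)

theorem Reach.of_le {V : Type*} [DecidableEq V] {G : SimpleGraph V} {p q : V → ℕ}
    (h : q ≤ p) : Reach G p q := ⟨p, .refl, h⟩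

theorem Reach.trans {V : Type*} [DecidableEq V] {G : SimpleGraph V} {p q s : V → ℕ}
    (h : Reach G p q) (h' : Reach G q s) : Reach G p s := by
  obtain ⟨c, hc, hqc⟩ := h
  obtain ⟨d, hd, hsd⟩ := h'
  refine ⟨d + (c - q), hc.trans ?_, ?_⟩
  · have := rtg_add_right hd (c - q)
    rwa [add_tsub_cancel_of_le hqc] at this
  · exact hsd.trans (le_add_of_nonneg_right (fun _ => Nat.zero_le _))

theorem Reach.add_right {V : Type*} [DecidableEq V] {G : SimpleGraph V} {p q : V → ℕ}
    (h : Reach G p q) (s : V → ℕ) : Reach G (p + s) (q + s) := by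
  obtain ⟨c, hc, hqc⟩ := h
  exact ⟨c + s, rtg_add_right hc s, fun x => Nat.add_le_add_right (hqc x) _⟩

theorem Reach.add {V : Type*} [DecidableEq V] {G : SimpleGraph V} {p q p' q' : V → ℕ}
    (h : Reach G p q) (h' : Reach G p' q') : Reach G (p + p') (q + q') := by
  refine (h.add_right p').trans ?_
  rw [add_comm q p', add_comm q q']
  exact h'.add_right q

theorem Reach.single {V : Type*} [DecidableEq V] {G : SimpleGraph V} {u v : V}
    (h : G.Adj u v) : Reach G (Pi.single u 2) (Pi.single v 1) := by
  refine ⟨_, .single ⟨u, v, h, by simp, rfl⟩, ?_⟩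
  intro x
  have := h.ne
  by_cases hx : x = v
  · subst hx
    simp [this.symm]
  · simp [hx]

theorem Reach.single_mul {V : Type*} [DecidableEq V] {G : SimpleGraph V} {u v : V}
    (h : G.Adj u v) (m : ℕ) : Reach G (Pi.single u (2 * m)) (Pi.single v m) := by
  induction m with
  | zero => exact .of_le (by simp)
  | succ m ih =>
    rw [mul_add, Pi.single_add, Pi.single_add]
    exact ih.add (.single h)

theorem Reach.sum {V ι : Type*} [DecidableEq V] {G : SimpleGraph V} (s : Finset ι)
    (p q : ι → V → ℕ) (h : ∀ i, Reach G (p i) (q i)) :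
    Reach G (∑ i ∈ s, p i) (∑ i ∈ s, q i) := by
  classical
  induction s using Finset.induction_on with
  | empty => exact .of_le le_rfl
  | insert a s ha ih =>
    rw [Finset.sum_insert ha, Finset.sum_insert ha]
    exact (h a).add ih

/-- The configuration on `V` obtained from `p` along `f`. -/
def push {V C : Type*} [DecidableEq V] [Fintype C] (f : C → V) (p : C → ℕ) : V → ℕ :=
  ∑ c, Pi.single (f c) (p c)

theorem push_add {V C : Type*} [DecidableEq V] [Fintype C] (f : C → V) (p q : C → ℕ) :
    push f (p + q) = push f p + push f q := by
  simp [push, Pi.single_add, Finset.sum_add_distrib]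

theorem exists_sub_sum {C : Type*} [Fintype C] (h : C → ℕ) (t : ℕ) (ht : t ≤ ∑ c, h c) :
    ∃ m : C → ℕ, (∀ c, m c ≤ h c) ∧ ∑ c, m c = t := by
  classical
  induction t with
  | zero => exact ⟨0, by simp, by simp⟩
  | succ t ih =>
    obtain ⟨m, hm, hs⟩ := ih (by omega)
    obtain ⟨c, -, hc⟩ := Finset.exists_lt_of_sum_lt (s := Finset.univ) (f := m) (g := h) (by omega)
    refine ⟨m + Pi.single c 1, fun d => ?_, ?_⟩
    · by_cases hd : d = c
      · subst hd; simpa using hc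
      · simpa [hd] using hm d
    · simp [Finset.sum_add_distrib, hs]

theorem sum_half {C : Type*} [Fintype C] (p : C → ℕ) :
    2 * ∑ c, p c / 2 + ∑ c, p c % 2 = ∑ c, p c := by
  rw [Finset.mul_sum, ← Finset.sum_add_distrib]
  exact Finset.sum_congr rfl fun c _ => by omega

/-- Moving `t` pebbles across a perfect matching. -/
theorem move_across {V C : Type*} [DecidableEq V] [Fintype C] {G : SimpleGraph V} (f g : C → V)
    (hfg : ∀ c, G.Adj (f c) (g c)) (p : C → ℕ) (t : ℕ) (ht : 2 * t + ∑ c, p c % 2 ≤ ∑ c, p c) :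
    ∃ p' m : C → ℕ, ∑ c, m c = t ∧ ∑ c, p' c + 2 * t = ∑ c, p c ∧
      ∑ c, p' c % 2 = ∑ c, p c % 2 ∧ Reach G (push f p) (push f p' + push g m) := by
  have := sum_half p
  obtain ⟨m, hm, hs⟩ := exists_sub_sum (fun c => p c / 2) t (by omega)
  have hm' : ∀ c, m c ≤ p c / 2 := hm
  refine ⟨fun c => p c - 2 * m c, m, hs, ?_, ?_, ?_⟩
  · rw [← hs, Finset.mul_sum, ← Finset.sum_add_distrib]
    exact Finset.sum_congr rfl fun c _ => by have := hm' c; omega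
  · exact Finset.sum_congr rfl fun c _ => by have := hm' c; beta_reduce; omega
  · have e : p = (fun c => p c - 2 * m c) + fun c => 2 * m c := by
      funext c; have := hm' c; simp only [Pi.add_apply]; omega
    conv_lhs => rw [e]
    rw [push_add]
    exact (Reach.of_le le_rfl).add (Reach.sum _ _ _ fun c => .single_mul (hfg c) _)

/-- `f` sends cube edges to edges of `G`. -/
def CubeHom {V : Type*} (G : SimpleGraph V) {n : ℕ} (f : (Fin n → Bool) → V) : Prop :=
  ∀ x i, G.Adj (f x) (f (Function.update x i (!(x i))))

theorem CubeHom.cons {V : Type*} {G : SimpleGraph V} {n : ℕ} {f : (Fin (n + 1) → Bool) → V}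
    (hf : CubeHom G f) (b : Bool) : CubeHom G (fun c : Fin n → Bool => f (Fin.cons b c)) := by
  intro x i
  have := hf (Fin.cons b x) i.succ
  rwa [Fin.cons_succ, ← Fin.cons_update] at this

theorem CubeHom.cross {V : Type*} {G : SimpleGraph V} {n : ℕ} {f : (Fin (n + 1) → Bool) → V}
    (hf : CubeHom G f) (c : Fin n → Bool) : G.Adj (f (Fin.cons true c)) (f (Fin.cons false c)) := by
  have := hf (Fin.cons true c) 0
  rwa [Fin.cons_zero, Fin.update_cons_zero] at this

theorem cube_sum {M : Type*} [AddCommMonoid M] {n : ℕ} (g : (Fin (n + 1) → Bool) → M) :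
    ∑ x, g x = ∑ c, g (Fin.cons false c) + ∑ c, g (Fin.cons true c) := by
  rw [← (Fin.consEquiv (fun _ : Fin (n + 1) => Bool)).sum_comp, Fintype.sum_prod_type,
    Fintype.sum_bool, add_comm]
  rfl

theorem chung {V : Type*} [DecidableEq V] (G : SimpleGraph V) (n : ℕ) :
    (∀ (f : (Fin n → Bool) → V) (p : (Fin n → Bool) → ℕ), CubeHom G f → 2 ^ n ≤ ∑ c, p c →
      Reach G (push f p) (Pi.single (f fun _ => false) 1)) ∧
    (∀ (f : (Fin n → Bool) → V) (p : (Fin n → Bool) → ℕ), CubeHom G f →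
      2 ^ (n + 1) < ∑ c, p c + ∑ c, p c % 2 →
      Reach G (push f p) (Pi.single (f fun _ => false) 2)) := by
  induction n with
  | zero =>
    have key : ∀ (f : (Fin 0 → Bool) → V) (p : (Fin 0 → Bool) → ℕ) (k : ℕ), k ≤ p (fun _ => false) →
        Reach G (push f p) (Pi.single (f fun _ => false) k) := by
      intro f p k hk
      apply Reach.of_le
      rw [push, Fintype.sum_subsingleton _ (fun _ => false)]
      exact Pi.single_mono _ hk
    constructor
    · intro f p _ h
      apply key
      rw [Fintype.sum_subsingleton _ (fun _ => false)] at h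
      simpa using h
    · intro f p _ h
      apply key
      rw [Fintype.sum_subsingleton _ (fun _ => false), Fintype.sum_subsingleton _ (fun _ => false)] at h
      omega
  | succ n ih =>
    obtain ⟨P, T⟩ := ih
    have root : ∀ f : (Fin (n + 1) → Bool) → V,
        f (fun _ => false) = f (Fin.cons false fun _ => false) := by
      intro f
      congr 1
      funext i
      refine Fin.cases ?_ (fun _ => ?_) i <;> simp
    have modle : ∀ p : (Fin n → Bool) → ℕ, ∑ c, p c % 2 ≤ ∑ c, p c := fun p =>
      Finset.sum_le_sum fun c _ => Nat.mod_le _ _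
    have modle2 : ∀ p : (Fin n → Bool) → ℕ, ∑ c, p c % 2 ≤ 2 ^ n := fun p => by
      calc ∑ c, p c % 2 ≤ ∑ c : Fin n → Bool, 1 := Finset.sum_le_sum fun c _ => by omega
        _ = 2 ^ n := by simp
    have zero_le' : ∀ q : V → ℕ, Reach G q 0 := fun q => .of_le fun _ => Nat.zero_le _
    constructor
    all_goals
      intro f p hf h
      rw [root f]
      have hp : push f p = push (fun c => f (Fin.cons false c)) (fun c => p (Fin.cons false c)) +
          push (fun c => f (Fin.cons true c)) (fun c => p (Fin.cons true c)) := cube_sum _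
      rw [hp]
      simp only [cube_sum] at h
      have hf0 := hf.cons false
      have hf1 := hf.cons true
      have hx := hf.cross
      generalize hg0 : (fun c : Fin n → Bool => f (Fin.cons false c)) = f0 at *
      generalize hg1 : (fun c : Fin n → Bool => f (Fin.cons true c)) = f1 at *
      have hx' : ∀ c, G.Adj (f1 c) (f0 c) := by rw [← hg0, ← hg1]; exact hx
      have hr : f (Fin.cons false fun _ => false) = f0 fun _ => false := by rw [← hg0]
      rw [hr]
      generalize hp0 : (fun c : Fin n → Bool => p (Fin.cons false c)) = p0
      generalize hp1 : (fun c : Fin n → Bool => p (Fin.cons true c)) = p1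
      have e0 : ∀ c, p (Fin.cons false c) = p0 c := fun c => by rw [← hp0]
      have e1 : ∀ c, p (Fin.cons true c) = p1 c := fun c => by rw [← hp1]
      simp only [e0, e1] at h
      have a0 := modle p0
      have a1 := modle p1
      have b0 := modle2 p0
      have b1 := modle2 p1
      have hs0 := sum_half p0
      have hs1 := sum_half p1
      have T0 := T f0 p0 hf0
      have P0 := P f0 p0 hf0
      have T1 := T f1 p1 hf1
      have X := (Reach.single (hx' fun _ => false))
      rw [pow_succ] at *
    · by_cases c1 : 2 ^ n ≤ ∑ c, p0 c
      · simpa using (P0 c1).add (zero_le' (push f1 p1))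
      by_cases c2 : ∑ c, p0 c < ∑ c, p1 c % 2
      · simpa using (zero_le' (push f0 p0)).add ((T1 (by omega)).trans X)
      obtain ⟨p', m, h1, h2, h3, h4⟩ := move_across f1 f0 hx' p1 (2 ^ n - ∑ c, p0 c) (by omega)
      have R := (Reach.of_le (G := G) (le_refl (push f0 p0))).add h4
      have e : push f0 p0 + (push f1 p' + push f0 m) = push f0 (p0 + m) + push f1 p' := by
        rw [push_add]; abel
      rw [e] at R
      refine R.trans ?_
      have := P f0 (p0 + m) hf0 (by
        simp only [Pi.add_apply, Finset.sum_add_distrib]; omega)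
      simpa using this.add (zero_le' (push f1 p'))
    · have tw : (Pi.single (f0 fun _ => false) 2 : V → ℕ) =
          Pi.single (f0 fun _ => false) 1 + Pi.single (f0 fun _ => false) 1 := by
        rw [← Pi.single_add]
      rw [pow_succ] at *
      by_cases c1 : 2 ^ n * 2 < ∑ c, p0 c + ∑ c, p0 c % 2
      · simpa using (T0 c1).add (zero_le' (push f1 p1))
      rw [tw]
      by_cases c2 : 2 ^ n ≤ ∑ c, p0 c
      · exact (P0 c2).add ((T1 (by omega)).trans X)
      obtain ⟨p', m, h1, h2, h3, h4⟩ := move_across f1 f0 hx' p1 (2 ^ n - ∑ c, p0 c) (by omega)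
      have R := (Reach.of_le (G := G) (le_refl (push f0 p0))).add h4
      have e : push f0 p0 + (push f1 p' + push f0 m) = push f0 (p0 + m) + push f1 p' := by
        rw [push_add]; abel
      rw [e] at R
      refine R.trans ?_
      have := P f0 (p0 + m) hf0 (by
        simp only [Pi.add_apply, Finset.sum_add_distrib]; omega)
      exact this.add ((T f1 p' hf1 (by omega)).trans X)

theorem cube_hom_id (n : ℕ) : CubeHom (cubeGraph n) (id : (Fin n → Bool) → _) := by
  intro x i
  have hd : hammingDist x (Function.update x i (!(x i))) = 1 := by
    unfold hammingDist
    rw [Finset.card_eq_one]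
    refine ⟨i, ?_⟩
    ext j
    by_cases hj : j = i
    · subst hj; simp
    · simp [hj]
  rw [cubeGraph, SimpleGraph.fromRel_adj]
  refine ⟨?_, Or.inl hd⟩
  intro he
  have := congrFun he i
  simp at this

theorem cube_solvable (n : ℕ) (p : (Fin n → Bool) → ℕ) (h : 2 ^ n ≤ ∑ v, p v) :
    Solvable (cubeGraph n) (fun _ => false) p := by
  have := (chung (cubeGraph n) n).1 id p (cube_hom_id n) h
  have e : push id p = p := by
    simp only [push, id]
    exact Finset.univ_sum_single p
  rw [e] at this
  obtain ⟨q, hq, hle⟩ := this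
  exact ⟨q, hq, by simpa using hle (fun _ => false)⟩

end PebbleHelpers

theorem stmt10 :
    (∀ p : (Fin 4 → Bool) → ℕ, ¬ Solvable (cubeGraph 4) (fun _ => false) p →
      confWeight (fun v => if v = (fun _ => false) then 0 else 4) p ≤ 60) ∧
    (∀ p : (Fin 4 → Bool) → ℕ, 16 ≤ ∑ v, p v →
      Solvable (cubeGraph 4) (fun _ => false) p) := by
  constructor
  · intro p hp
    have h : ∑ v, p v ≤ 15 := by
      by_contra hc
      exact hp (cube_solvable 4 p (by norm_num; omega))
    have h' : (∑ v, (p v : ℝ)) ≤ 15 := by exact_mod_cast h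
    unfold confWeight
    calc _ ≤ ∑ v, (p v : ℝ) * 4 := by
          refine Finset.sum_le_sum fun v _ => ?_
          refine mul_le_mul_of_nonneg_left ?_ (Nat.cast_nonneg _)
          beta_reduce
          split_ifs <;> norm_num
      _ = (∑ v, (p v : ℝ)) * 4 := by rw [Finset.sum_mul]
      _ ≤ 60 := by linarith
  · intro p hp
    exact cube_solvable 4 p (by norm_num; omega)
end
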